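/- Let m be a positive integer. There exists a constant C > 1 depending only on m such that for all p, q ∈ (0, m) with p + q > m, all α ∈ (0, p+q−m], and all ℓ ≥ 1, one has ∫_{w ∈ ℝ^m, |z−w| > ℓ} |w|^(−p) |z−w|^(−q) dw ≤ C (1/(m−p) + 1/(m−q) + 1/(p+q−m)) ⟨z⟩^(−α) for all z ∈ ℝ^m. -/

import Mathlib

open MeasureTheory Set

lemma radial_aux (m : ℕ) (hm : 0 < m) (a : ℝ) (S : Set ℝ) (hS : MeasurableSet S)
    (hS0 : S ⊆ Ioi 0) (hint : IntegrableOn (fun y : ℝ => y ^ ((m:ℝ) - 1 - a)) S) :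
    Integrable (fun w : EuclideanSpace ℝ (Fin m) => S.indicator (fun y : ℝ => y ^ (-a)) ‖w‖) ∧
    ∫ w : EuclideanSpace ℝ (Fin m), S.indicator (fun y : ℝ => y ^ (-a)) ‖w‖ =
      m * (volume.real (Metric.ball (0 : EuclideanSpace ℝ (Fin m)) 1) *
        ∫ y in S, y ^ ((m:ℝ) - 1 - a)) := by
  have : Nonempty (Fin m) := ⟨⟨0, hm⟩⟩
  have key : ∀ y ∈ Ioi (0:ℝ), y ^ (m - 1) • S.indicator (fun y : ℝ => y ^ (-a)) y
      = S.indicator (fun y : ℝ => y ^ ((m:ℝ) - 1 - a)) y := by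
    intro y hy
    by_cases h : y ∈ S
    · simp only [indicator_of_mem h, smul_eq_mul]
      rw [← Real.rpow_natCast, ← Real.rpow_add hy]
      congr 1
      rw [Nat.cast_sub hm]; push_cast; ring
    · simp [indicator_of_notMem h]
  have hinter : S ∩ Ioi 0 = S := inter_eq_left.mpr hS0
  constructor
  · rw [integrable_fun_norm_addHaar volume (f := S.indicator (fun y : ℝ => y ^ (-a)))]
    rw [finrank_euclideanSpace_fin, integrableOn_congr_fun key measurableSet_Ioi]
    exact ((integrable_indicator_iff hS).2 hint).integrableOn
  · rw [integral_fun_norm_addHaar volume (S.indicator (fun y : ℝ => y ^ (-a)))]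
    rw [finrank_euclideanSpace_fin, setIntegral_congr_fun measurableSet_Ioi key,
      setIntegral_indicator hS, inter_comm, hinter]
    simp

lemma inner_aux (m : ℕ) (hm : 0 < m) (a t : ℝ) (ha : a < m) (ht : 0 < t) :
    Integrable (fun w : EuclideanSpace ℝ (Fin m) =>
      (Ioc 0 t).indicator (fun y : ℝ => y ^ (-a)) ‖w‖) ∧
    ∫ w : EuclideanSpace ℝ (Fin m), (Ioc 0 t).indicator (fun y : ℝ => y ^ (-a)) ‖w‖ =
      m * (volume.real (Metric.ball (0 : EuclideanSpace ℝ (Fin m)) 1) *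
        (t ^ (m - a) / (m - a))) := by
  have h := radial_aux m hm a (Ioc 0 t) measurableSet_Ioc (fun x hx => hx.1)
    ((intervalIntegrable_iff_integrableOn_Ioc_of_le ht.le).1
      (intervalIntegral.intervalIntegrable_rpow' (by linarith)))
  rw [← intervalIntegral.integral_of_le ht.le, integral_rpow (Or.inl (by linarith)),
    Real.zero_rpow (by linarith)] at h
  rw [show (m:ℝ) - 1 - a + 1 = m - a by ring, sub_zero] at h
  exact h

lemma outer_aux (m : ℕ) (hm : 0 < m) (a t : ℝ) (ha : m < a) (ht : 0 < t) :
    Integrable (fun w : EuclideanSpace ℝ (Fin m) =>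
      (Ioi t).indicator (fun y : ℝ => y ^ (-a)) ‖w‖) ∧
    ∫ w : EuclideanSpace ℝ (Fin m), (Ioi t).indicator (fun y : ℝ => y ^ (-a)) ‖w‖ =
      m * (volume.real (Metric.ball (0 : EuclideanSpace ℝ (Fin m)) 1) *
        (t ^ (m - a) / (a - m))) := by
  have h := radial_aux m hm a (Ioi t) measurableSet_Ioi (fun x hx => ht.trans hx)
    (integrableOn_Ioi_rpow_of_lt (by linarith) ht)
  rw [integral_Ioi_rpow_of_lt (by linarith) ht] at h
  rw [show (m:ℝ) - 1 - a + 1 = m - a by ring, neg_div, ← div_neg, neg_sub] at h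
  exact h

lemma pointwise_aux (p q t a b : ℝ) (hp : 0 < p) (hq : 0 < q) (ht : 0 < t) (ha : 0 ≤ a)
    (hb : 0 < b) (h : a ≤ t → t ≤ b) :
    a ^ (-p) * b ^ (-q) ≤
      t ^ (-q) * (Ioc 0 t).indicator (fun y : ℝ => y ^ (-p)) a +
      t ^ (-p) * (Ioc 0 t).indicator (fun y : ℝ => y ^ (-q)) b +
      (Ioi t).indicator (fun y : ℝ => y ^ (-(p + q))) a +
      (Ioi t).indicator (fun y : ℝ => y ^ (-(p + q))) b := by
  have nn : ∀ (S : Set ℝ) (r x : ℝ), 0 ≤ x → 0 ≤ S.indicator (fun y : ℝ => y ^ r) x := by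
    intro S r x hx
    by_cases h : x ∈ S
    · rw [indicator_of_mem h]; positivity
    · rw [indicator_of_notMem h]
  have n1 := mul_nonneg (Real.rpow_nonneg ht.le (-q)) (nn (Ioc 0 t) (-p) a ha)
  have n2 := mul_nonneg (Real.rpow_nonneg ht.le (-p)) (nn (Ioc 0 t) (-q) b hb.le)
  have n3 := nn (Ioi t) (-(p+q)) a ha
  have n4 := nn (Ioi t) (-(p+q)) b hb.le
  rcases ha.eq_or_lt with h0 | h0
  · have hz : a ^ (-p) = 0 := by rw [← h0]; exact Real.zero_rpow (by linarith)
    rw [hz, zero_mul]; linarith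
  have hap : 0 ≤ a ^ (-p) := by positivity
  have hbq : 0 ≤ b ^ (-q) := by positivity
  rcases le_or_gt a t with h1 | h1
  · rw [indicator_of_mem (show a ∈ Ioc 0 t from ⟨h0, h1⟩)] at n1 ⊢
    have := Real.rpow_le_rpow_of_nonpos ht (h h1) (show -q ≤ 0 by linarith)
    nlinarith [mul_le_mul_of_nonneg_left this hap]
  rcases le_or_gt b t with h2 | h2
  · rw [indicator_of_mem (show b ∈ Ioc 0 t from ⟨hb, h2⟩)] at n2 ⊢
    have := Real.rpow_le_rpow_of_nonpos ht h1.le (show -p ≤ 0 by linarith)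
    nlinarith [mul_le_mul_of_nonneg_right this hbq]
  rcases le_total a b with h3 | h3
  · rw [indicator_of_mem (show a ∈ Ioi t from h1)] at n3 ⊢
    have := Real.rpow_le_rpow_of_nonpos h0 h3 (show -q ≤ 0 by linarith)
    have e : a ^ (-(p+q)) = a ^ (-p) * a ^ (-q) := by rw [← Real.rpow_add h0]; congr 1; ring
    simp only [e]
    nlinarith [mul_le_mul_of_nonneg_left this hap]
  · rw [indicator_of_mem (show b ∈ Ioi t from h2)] at n4 ⊢
    have := Real.rpow_le_rpow_of_nonpos hb h3 (show -p ≤ 0 by linarith)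
    have e : b ^ (-(p+q)) = b ^ (-p) * b ^ (-q) := by rw [← Real.rpow_add hb]; congr 1; ring
    simp only [e]
    nlinarith [mul_le_mul_of_nonneg_right this hbq]

lemma decay_aux (m s α r : ℝ) (hs : s ≤ m) (hα : 0 < α) (hαs : α ≤ s) (hr : 0 ≤ r) :
    (max 1 r / 2) ^ (-s) ≤ 4 ^ m * (1 + r ^ 2) ^ (-α / 2) := by
  set M := max 1 r with hM
  have hM1 : 1 ≤ M := le_max_left _ _
  have hMr : r ≤ M := le_max_right _ _
  have e1 : (M / 2) ^ (-s) = 2 ^ s * M ^ (-s) := by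
    rw [Real.div_rpow (by linarith) (by norm_num), Real.rpow_neg (by norm_num : (0:ℝ) ≤ 2)]
    rw [div_inv_eq_mul, mul_comm]
  have e2 : M ^ (-s) ≤ M ^ (-α) := Real.rpow_le_rpow_of_exponent_le hM1 (by linarith)
  have e3 : M ^ (-α) ≤ 2 ^ s * (1 + r ^ 2) ^ (-α / 2) := by
    have h1 : (4 * M ^ 2) ^ (-α / 2) ≤ (1 + r ^ 2) ^ (-α / 2) :=
      Real.rpow_le_rpow_of_nonpos (by positivity) (by nlinarith) (by linarith)
    have h2 : (4 * M ^ 2) ^ (-α / 2) = 2 ^ (-α) * M ^ (-α) := by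
      rw [show 4 * M ^ 2 = (2 * M) ^ (2:ℝ) by rw [Real.rpow_two]; ring,
        ← Real.rpow_mul (by linarith), Real.mul_rpow (by norm_num) (by linarith)]
      congr 2 <;> ring
    rw [h2] at h1
    calc M ^ (-α) = 2 ^ α * (2 ^ (-α) * M ^ (-α)) := by
          rw [← mul_assoc, ← Real.rpow_add (by norm_num)]; simp
      _ ≤ 2 ^ s * (1 + r ^ 2) ^ (-α / 2) := by
          gcongr
          norm_num
  have e4 : (2:ℝ) ^ s * 2 ^ s ≤ 4 ^ m := by
    rw [← Real.mul_rpow (by norm_num) (by norm_num)]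
    norm_num
    exact hs
  rw [e1]
  calc (2:ℝ) ^ s * M ^ (-s) ≤ 2 ^ s * (2 ^ s * (1 + r ^ 2) ^ (-α / 2)) := by
        gcongr; exact e2.trans e3
    _ = (2 ^ s * 2 ^ s) * (1 + r ^ 2) ^ (-α / 2) := by ring
    _ ≤ _ := by gcongr

/-- Lemma A.3: convolution bound over the exterior region `{w : ‖z - w‖ > ℓ}` in the
supercritical range `p + q > m`, with Japanese-bracket decay `⟨z⟩^{-α}`. -/
theorem convolution_far (m : ℕ) (hm : 0 < m) :
    ∃ C : ℝ, 1 < C ∧ ∀ p q α ℓ : ℝ, p ∈ Set.Ioo (0:ℝ) (m:ℝ) → q ∈ Set.Ioo (0:ℝ) (m:ℝ) →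
      (m:ℝ) < p + q → α ∈ Set.Ioc (0:ℝ) (p + q - (m:ℝ)) → 1 ≤ ℓ →
      ∀ z : EuclideanSpace ℝ (Fin m),
        (∫ w in {w : EuclideanSpace ℝ (Fin m) | ℓ < ‖z - w‖}, ‖w‖ ^ (-p) * ‖z - w‖ ^ (-q))
          ≤ C * (1 / ((m:ℝ) - p) + 1 / ((m:ℝ) - q) + 1 / (p + q - (m:ℝ)))
            * (1 + ‖z‖ ^ 2) ^ (-α / 2) := by
  set V := volume.real (Metric.ball (0 : EuclideanSpace ℝ (Fin m)) 1) with hV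
  have hV0 : 0 ≤ V := measureReal_nonneg
  refine ⟨2 + 2 * (m * V) * 4 ^ (m:ℝ), ?_, ?_⟩
  · have : 0 ≤ 2 * (m * V) * 4 ^ (m:ℝ) := by positivity
    linarith
  rintro p q α ℓ ⟨hp0, hpm⟩ ⟨hq0, hqm⟩ hpq ⟨hα0, hα⟩ hℓ z
  set t := max 1 ‖z‖ / 2 with ht
  have ht0 : 0 < t := by positivity
  obtain ⟨ip, vp⟩ := inner_aux m hm p t hpm ht0
  obtain ⟨iq, vq⟩ := inner_aux m hm q t hqm ht0
  obtain ⟨io, vo⟩ := outer_aux m hm (p + q) t hpq ht0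
  set F : EuclideanSpace ℝ (Fin m) → ℝ := fun w =>
      t ^ (-q) * (Ioc 0 t).indicator (fun y : ℝ => y ^ (-p)) ‖w‖ +
      t ^ (-p) * (Ioc 0 t).indicator (fun y : ℝ => y ^ (-q)) ‖z - w‖ +
      (Ioi t).indicator (fun y : ℝ => y ^ (-(p + q))) ‖w‖ +
      (Ioi t).indicator (fun y : ℝ => y ^ (-(p + q))) ‖z - w‖ with hF
  have iq' := iq.comp_sub_left z
  have io' := io.comp_sub_left z
  have iF : Integrable F := (((ip.const_mul _).add (iq'.const_mul _)).add io).add io'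
  have F0 : ∀ w, 0 ≤ F w := by
    have nn : ∀ (S : Set ℝ) (r x : ℝ), 0 ≤ x → 0 ≤ S.indicator (fun y : ℝ => y ^ r) x := by
      intro S r x hx
      by_cases h : x ∈ S
      · rw [indicator_of_mem h]; positivity
      · rw [indicator_of_notMem h]
    intro w
    have h1 := nn (Ioc 0 t) (-p) ‖w‖ (norm_nonneg _)
    have h2 := nn (Ioc 0 t) (-q) ‖z - w‖ (norm_nonneg _)
    have h3 := nn (Ioi t) (-(p+q)) ‖w‖ (norm_nonneg _)
    have h4 := nn (Ioi t) (-(p+q)) ‖z - w‖ (norm_nonneg _)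
    simp only [hF]
    positivity
  have hmeas : MeasurableSet {w : EuclideanSpace ℝ (Fin m) | ℓ < ‖z - w‖} :=
    (isOpen_lt continuous_const (by fun_prop)).measurableSet
  have step1 : (∫ w in {w : EuclideanSpace ℝ (Fin m) | ℓ < ‖z - w‖},
      ‖w‖ ^ (-p) * ‖z - w‖ ^ (-q)) ≤ ∫ w, F w := by
    refine le_trans (integral_mono_of_nonneg (g := F) ?_ iF.integrableOn ?_)
      (setIntegral_le_integral iF (Filter.Eventually.of_forall F0))
    · exact Filter.Eventually.of_forall fun w => by simp only [Pi.zero_apply]; positivity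
    · refine (ae_restrict_iff' hmeas).2 (Filter.Eventually.of_forall fun w hw => ?_)
      have hw' : ℓ < ‖z - w‖ := hw
      refine pointwise_aux p q t ‖w‖ ‖z - w‖ hp0 hq0 ht0 (norm_nonneg _) (by linarith) ?_
      intro h
      have tri : ‖z‖ ≤ ‖z - w‖ + ‖w‖ := by simpa using norm_add_le (z - w) w
      rcases le_total 1 ‖z‖ with h1 | h1
      · rw [max_eq_right h1] at ht; linarith
      · rw [max_eq_left h1] at ht; linarith
  have step2 : ∫ w, F w = m * V * t ^ (-(p + q - m)) *
      (1 / ((m:ℝ) - p) + 1 / ((m:ℝ) - q) + 2 * (1 / (p + q - (m:ℝ)))) := by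
    have s1 : ∫ w, F w = t ^ (-q) * (m * (V * (t ^ (m - p) / (m - p)))) +
        t ^ (-p) * (m * (V * (t ^ (m - q) / (m - q)))) +
        m * (V * (t ^ (m - (p + q)) / (p + q - m))) +
        m * (V * (t ^ (m - (p + q)) / (p + q - m))) := by
      simp only [hF]
      rw [integral_add ?_ io', integral_add ?_ io,
        integral_add (ip.const_mul _) (iq'.const_mul _), integral_const_mul, integral_const_mul,
        integral_sub_left_eq_self
          (fun w => (Ioc 0 t).indicator (fun y : ℝ => y ^ (-q)) ‖w‖) volume z,
        integral_sub_left_eq_self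
          (fun w => (Ioi t).indicator (fun y : ℝ => y ^ (-(p + q))) ‖w‖) volume z, vp, vq, vo]
      · exact (ip.const_mul _).add (iq'.const_mul _)
      · exact ((ip.const_mul _).add (iq'.const_mul _)).add io
    have e1 : t ^ (-(p + q - m)) = t ^ (-q) * t ^ (m - p) := by
      rw [← Real.rpow_add ht0]; congr 1; ring
    have e2 : t ^ (-(p + q - m)) = t ^ (-p) * t ^ (m - q) := by
      rw [← Real.rpow_add ht0]; congr 1; ring
    have e3 : t ^ (m - (p + q)) = t ^ (-(p + q - m)) := by
      congr 1; ring
    rw [s1, e3]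
    linear_combination (-(m * V / (m - p))) * e1 + (-(m * V / (m - q))) * e2
  have hd := decay_aux m (p + q - m) α ‖z‖ (by linarith) hα0 hα (norm_nonneg _)
  rw [← ht] at hd
  have x1 : 0 < 1 / ((m:ℝ) - p) := by apply one_div_pos.2; linarith
  have x2 : 0 < 1 / ((m:ℝ) - q) := by apply one_div_pos.2; linarith
  have x3 : 0 < 1 / (p + q - (m:ℝ)) := by apply one_div_pos.2; linarith
  refine step1.trans (step2.le.trans ?_)
  set D := (1 + ‖z‖ ^ 2) ^ (-α / 2) with hD
  have hD0 : 0 ≤ D := by positivity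
  set A := 1 / ((m:ℝ) - p)
  set B := 1 / ((m:ℝ) - q)
  set E := 1 / (p + q - (m:ℝ))
  calc m * V * t ^ (-(p + q - m)) * (A + B + 2 * E)
      ≤ m * V * (4 ^ (m:ℝ) * D) * (2 * (A + B + E)) := by
        gcongr
        linarith
    _ = (2 * (m * V) * 4 ^ (m:ℝ)) * (A + B + E) * D := by ring
    _ ≤ (2 + 2 * (m * V) * 4 ^ (m:ℝ)) * (A + B + E) * D := by
        gcongr
        linarith
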